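/- Let 0 < j < 3^n − 1 with ternary digits j_i. Suppose j ∈ S_1, {j_0, j_{(n−k) mod n}} = {1, 2}, {j_1, j_{(1−k) mod n}} = {0, 1}, and (j_1, j_0) = (1, 2). Then j_{ik mod n} = 1 for all w ≤ i ≤ n−1; j_0 = 2; j_{ik mod n} = 0 for i ∈ {1, w−1}; j_{ik mod n} ∈ {0, 2} for all 2 ≤ i ≤ w−2; and no two consecutive terms of the sequence (j_{ik mod n})_{i=2}^{w−2} both equal 2. -/

import Mathlib

/-- The `i`-th ternary digit (indices read modulo `n`) of the residue of `j` modulo `3^n - 1`. -/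
def dig (n : ℕ) (j : ℤ) (i : ℕ) : ℕ :=
  ((j % ((3 : ℤ) ^ n - 1)).toNat / 3 ^ (i % n)) % 3

/-- The ternary weight of (the residue modulo `3^n - 1` of) `j`. -/
def wt (n : ℕ) (j : ℤ) : ℕ := ∑ i ∈ Finset.range n, dig n j i

/-- `d = (3^k + 1)/2`. -/
def cmD (k : ℕ) : ℤ := ((3 : ℤ) ^ k + 1) / 2

/-- The set `S_1`. -/
def S1 (n k : ℕ) : Set ℤ :=
  {j | 0 < j ∧ j < 3 ^ n - 1 ∧
    wt n j + wt n (3 ^ k * j) = wt n ((3 ^ k + 1) * j) + 2 ∧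
    2 * wt n (-(j * cmD k)) = wt n (-((3 ^ k + 1) * j))}

theorem dig_congr {n a b : ℕ} (j : ℤ) (h : a ≡ b [MOD n]) : dig n j a = dig n j b := by
  unfold dig
  rw [show a % n = b % n from h]

theorem dig_le_two (n : ℕ) (j : ℤ) (i : ℕ) : dig n j i ≤ 2 :=
  Nat.le_of_lt_succ (Nat.mod_lt _ (by norm_num))

theorem two_le_three_pow_sub_one {n : ℕ} (hn : 0 < n) : (2 : ℤ) ≤ 3 ^ n - 1 := by
  have h : (3 : ℤ) ^ 1 ≤ 3 ^ n := pow_le_pow_right₀ (by norm_num) hn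
  linarith

theorem exists_residue {n : ℕ} (hn : 0 < n) (x : ℤ) :
    ∃ X : ℕ, (X : ℤ) = x % (3 ^ n - 1) ∧ X + 1 < 3 ^ n ∧
      ∀ i, i < n → dig n x i = X / 3 ^ i % 3 := by
  have hN := two_le_three_pow_sub_one hn
  have h0 := Int.emod_nonneg x (show (3 : ℤ) ^ n - 1 ≠ 0 by linarith)
  have h1 := Int.emod_lt_of_pos x (show (0 : ℤ) < 3 ^ n - 1 by linarith)
  refine ⟨(x % (3 ^ n - 1)).toNat, Int.toNat_of_nonneg h0, ?_, fun i hi => ?_⟩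
  · zify
    rw [Int.toNat_of_nonneg h0]
    linarith
  · rw [dig, Nat.mod_eq_of_lt hi]

theorem dig_three_mul_succ {n : ℕ} (hn : 0 < n) (x : ℤ) (i : ℕ) :
    dig n (3 * x) (i + 1) = dig n x i := by
  obtain ⟨X, hX, hXlt, hXd⟩ := exists_residue hn x
  obtain ⟨Y, hY, hYlt, hYd⟩ := exists_residue hn (3 * x)
  obtain ⟨m, rfl⟩ : ∃ m, n = m + 1 := ⟨n - 1, by omega⟩
  have hpow : (3 : ℕ) ^ (m + 1) = 3 * 3 ^ m := by ring
  have hq : X / 3 ^ m < 3 := by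
    rw [Nat.div_lt_iff_lt_mul (by positivity)]; omega
  have hXdm := Nat.div_add_mod X (3 ^ m)
  have hr : X % 3 ^ m < 3 ^ m := Nat.mod_lt _ (by positivity)
  generalize hqe : X / 3 ^ m = q at *
  generalize hre : X % 3 ^ m = r at *
  have hlt : 3 * r + q + 1 < 3 ^ (m + 1) := by
    by_contra hge
    have h2 : q = 2 := by omega
    have h3 : r + 1 = 3 ^ m := by omega
    rw [h2] at hXdm
    omega
  have hYeq : Y = 3 * r + q := by
    zify
    have hlt' : (3 * r + q : ℤ) + 1 < 3 ^ (m + 1) := by exact_mod_cast hlt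
    have hXz : (X : ℤ) = 3 ^ m * q + r := by exact_mod_cast hXdm.symm
    rw [hY, show 3 * x = 3 * r + q + (3 ^ (m + 1) - 1) * (q + 3 * (x / (3 ^ (m + 1) - 1))) by
      have := Int.emod_add_mul_ediv x (3 ^ (m + 1) - 1)
      rw [← hX, hXz] at this
      linear_combination -3 * this, Int.add_mul_emod_self_left]
    exact Int.emod_eq_of_lt (by positivity) (by linarith)
  have hle : i % (m + 1) ≤ m := Nat.le_of_lt_succ (Nat.mod_lt i hn)
  rcases hle.eq_or_lt with hi | hi
  · have him : i ≡ m [MOD m + 1] := by simp [Nat.ModEq, hi]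
    rw [dig_congr x him, hXd m (by omega), hqe,
      dig_congr (3 * x) ((him.add_right 1).trans (Nat.modEq_zero_iff_dvd.2 dvd_rfl)), hYd 0 hn, hYeq]
    omega
  · rw [← dig_congr x (Nat.mod_modEq i (m + 1)),
      ← dig_congr (3 * x) ((Nat.mod_modEq i (m + 1)).add_right 1), hXd _ (by omega),
      hYd _ (by omega), hYeq]
    generalize i % (m + 1) = l at hi ⊢
    obtain ⟨p, rfl⟩ : ∃ p, m = l + 1 + p := ⟨m - (l + 1), by omega⟩
    rw [pow_succ', ← Nat.div_div_eq_div_mul, show (3 * r + q) / 3 = r by omega, ← hXdm,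
      show 3 ^ (l + 1 + p) * q + r = r + 3 ^ l * (3 * (3 ^ p * q)) by ring,
      Nat.add_mul_div_left _ _ (by positivity), Nat.add_mul_mod_self_left]

/-- Carries in the addition of two residues modulo `3 ^ n - 1`. -/
theorem exists_carry {n : ℕ} (hn : 0 < n) (x y : ℤ) :
    ∃ c : ℕ → ℕ, c n = c 0 ∧ (∀ i, c i ≤ 1) ∧
      ∀ i, i < n → dig n x i + dig n y i + c i = dig n (x + y) i + 3 * c (i + 1) := by
  obtain ⟨X, hX, hXlt, hXd⟩ := exists_residue hn x
  obtain ⟨Y, hY, hYlt, hYd⟩ := exists_residue hn y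
  obtain ⟨Z, hZ, hZlt, hZd⟩ := exists_residue hn (x + y)
  have hN := two_le_three_pow_sub_one hn
  obtain ⟨e, he⟩ : ∃ e : ℕ, X + Y + e = Z + e * 3 ^ n := by
    rw [Int.add_emod, ← hX, ← hY] at hZ
    refine ⟨((X + Y : ℤ) / (3 ^ n - 1)).toNat, ?_⟩
    zify
    rw [Int.toNat_of_nonneg (Int.ediv_nonneg (by positivity) (by linarith)), hZ]
    have := Int.emod_add_mul_ediv (X + Y : ℤ) (3 ^ n - 1)
    linarith
  have hsplit (W i : ℕ) : W % 3 ^ (i + 1) = W % 3 ^ i + 3 ^ i * (W / 3 ^ i % 3) := by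
    rw [pow_succ, Nat.mod_mul]
  have key (i : ℕ) (hi : i ≤ n) :
      X % 3 ^ i + Y % 3 ^ i + e = (X % 3 ^ i + Y % 3 ^ i + e) / 3 ^ i * 3 ^ i + Z % 3 ^ i := by
    have h : (X % 3 ^ i + Y % 3 ^ i + e) % 3 ^ i = Z % 3 ^ i := by
      have h1 : X % 3 ^ i + Y % 3 ^ i + e ≡ X + Y + e [MOD 3 ^ i] :=
        ((Nat.mod_modEq _ _).add (Nat.mod_modEq _ _)).add_right e
      have h2 : Z + e * 3 ^ n ≡ Z + 0 [MOD 3 ^ i] :=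
        Nat.ModEq.add_left Z
          ((Nat.modEq_zero_iff_dvd).2 ((pow_dvd_pow 3 hi).mul_left e))
      exact h1.trans (he ▸ h2)
    rw [← h]
    exact (Nat.div_add_mod' _ _).symm
  have he1 : e ≤ 1 := by
    by_contra! h
    have := Nat.mul_le_mul_right (3 ^ n) h
    nlinarith
  refine ⟨fun i => (X % 3 ^ i + Y % 3 ^ i + e) / 3 ^ i, ?_, fun i => ?_, fun i hi => ?_⟩
  · dsimp only
    rw [Nat.mod_eq_of_lt (by omega : X < 3 ^ n), Nat.mod_eq_of_lt (by omega : Y < 3 ^ n), he,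
      Nat.add_mul_div_right _ _ (by positivity), Nat.div_eq_of_lt (by omega : Z < 3 ^ n)]
    simp [Nat.mod_one]
  · have hp : 0 < 3 ^ i := by positivity
    have hx := Nat.mod_lt X hp
    have hy := Nat.mod_lt Y hp
    exact Nat.le_of_lt_succ ((Nat.div_lt_iff_lt_mul hp).2 (by omega))
  · have h1 := key i hi.le
    have h2 := key (i + 1) hi
    dsimp only
    generalize (X % 3 ^ i + Y % 3 ^ i + e) / 3 ^ i = c at *
    generalize (X % 3 ^ (i + 1) + Y % 3 ^ (i + 1) + e) / 3 ^ (i + 1) = c' at *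
    rw [hsplit X, hsplit Y, hsplit Z, ← hXd i hi, ← hYd i hi, ← hZd i hi, pow_succ] at h2
    have hp : 0 < 3 ^ i := by positivity
    refine Nat.eq_of_mul_eq_mul_left hp ?_
    linarith

theorem sum_carry {n : ℕ} {x y : ℤ} {c : ℕ → ℕ} (hc : c n = c 0)
    (h : ∀ i, i < n → dig n x i + dig n y i + c i = dig n (x + y) i + 3 * c (i + 1)) :
    wt n x + wt n y = wt n (x + y) + 2 * ∑ i ∈ Finset.range n, c (i + 1) := by
  have h1 := Finset.sum_congr rfl fun i hi => h i (Finset.mem_range.1 hi)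
  simp only [Finset.sum_add_distrib, ← Finset.mul_sum] at h1
  have h2 := Finset.sum_range_succ c n
  rw [Finset.sum_range_succ' c n] at h2
  unfold wt
  omega

theorem dig_three_pow_mul {n : ℕ} (hn : 0 < n) (x : ℤ) (k i : ℕ) :
    dig n (3 ^ k * x) (i + k) = dig n x i := by
  induction k with
  | zero => simp
  | succ k ih => rw [pow_succ', mul_assoc, ← add_assoc, dig_three_mul_succ hn, ih]

theorem even_dig_of_even_dig_neg {n : ℕ} (hn : 0 < n) {x : ℤ}
    (h : ∀ i, i < n → Even (dig n (-x) i)) {i : ℕ} (hi : i < n) : Even (dig n x i) := by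
  obtain ⟨c, hc, hc1, hcar⟩ := exists_carry hn x (-x)
  have hz (i : ℕ) : dig n (x + -x) i = 0 := by simp [dig]
  simp only [hz, zero_add] at hcar
  have hmono : ∀ a b, a ≤ b → b ≤ n → c a ≤ c b := by
    intro a b hab
    induction b, hab using Nat.le_induction with
    | base => simp
    | succ b _ ih =>
      intro hb
      have := ih (by omega)
      have := hcar b hb
      have := hc1 b
      have := dig_le_two n x b
      have := dig_le_two n (-x) b
      omega
  have h1 := hmono 0 i (by omega) hi.le
  have h2 := hmono i (i + 1) (by omega) hi
  have h3 := hmono (i + 1) n hi le_rfl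
  have h4 := hcar i hi
  have h5 := h i hi
  rw [Nat.even_iff] at h5 ⊢
  omega

theorem even_dig_two_mul {n : ℕ} (hn : 0 < n) {t : ℤ} (h : 2 * wt n t = wt n (t + t)) {i : ℕ}
    (hi : i < n) : Even (dig n (t + t) i) := by
  obtain ⟨c, hc, -, hcar⟩ := exists_carry hn t t
  have hs := sum_carry hc hcar
  have hs0 : ∑ i ∈ Finset.range n, c (i + 1) = 0 := by omega
  have hc0 : ∀ i, i < n → c (i + 1) = 0 := by simpa using hs0
  have hci : c i = 0 := by
    rcases i with _ | i
    · have := hc0 (n - 1) (by omega)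
      rwa [Nat.sub_add_cancel hn, hc] at this
    · exact hc0 i (by omega)
  have := hcar i hi
  have := hc0 i hi
  rw [Nat.even_iff]
  omega

theorem two_mul_cmD (k : ℕ) : 2 * cmD k = 3 ^ k + 1 :=
  Int.mul_ediv_cancel' ((Odd.pow (by decide : Odd (3 : ℤ))).add_odd odd_one).two_dvd

theorem even_dig_add_dig {n k : ℕ} (hn : 2 ≤ n) (hkn : k < n) {j : ℤ} (hj : j ∈ S1 n k)
    (h0 : dig n j 0 + dig n j (n - k) = 3) {i : ℕ} (hi : 2 ≤ i) (hin : i < n) :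
    dig n j i + dig n j (i + (n - k)) = 0 ∨ dig n j i + dig n j (i + (n - k)) = 2 := by
  have hn0 : 0 < n := by omega
  obtain ⟨-, -, hw1, hw2⟩ := hj
  have hshift (i : ℕ) : dig n (3 ^ k * j) i = dig n j (i + (n - k)) := by
    rw [← dig_three_pow_mul hn0 j k]
    refine dig_congr _ ?_
    rw [add_assoc, Nat.sub_add_cancel hkn.le]
    exact (Nat.add_modEq_right).symm
  have hsum : (3 ^ k + 1) * j = j + 3 ^ k * j := by ring
  have heven : Even (dig n (j + 3 ^ k * j) i) := by
    refine even_dig_of_even_dig_neg hn0 (fun i hi => ?_) hin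
    have ht : -(j + 3 ^ k * j) = -(j * cmD k) + -(j * cmD k) := by
      linear_combination j * two_mul_cmD k
    rw [hsum, ht] at hw2
    rw [ht]
    exact even_dig_two_mul hn0 hw2 hi
  rw [hsum] at hw1
  obtain ⟨c, hc, -, hcar⟩ := exists_carry hn0 j (3 ^ k * j)
  have hs := sum_carry hc hcar
  have hs1 : ∑ i ∈ Finset.range n, c (i + 1) = 1 := by omega
  have hc1 : 1 ≤ c 1 := by
    have h := hcar 0 hn0
    rw [hshift, zero_add, zero_add, h0] at h
    have := dig_le_two n (j + 3 ^ k * j) 0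
    omega
  have hzero : ∀ i, 0 < i → i < n → c (i + 1) = 0 := by
    intro i hi hin
    have hle : ∑ m ∈ {0, i}, c (m + 1) ≤ ∑ m ∈ Finset.range n, c (m + 1) :=
      Finset.sum_le_sum_of_subset (by
        intro m hm
        simp only [Finset.mem_insert, Finset.mem_singleton] at hm
        simp only [Finset.mem_range]
        omega)
    rw [Finset.sum_pair (by omega), hs1] at hle
    simp only [zero_add] at hle
    omega
  have h := hcar i hin
  have hci := hzero (i - 1) (by omega) (by omega)
  rw [Nat.sub_add_cancel (by omega)] at hci
  rw [hci, hzero i (by omega) hin, hshift] at h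
  have := dig_le_two n (j + 3 ^ k * j) i
  rw [Nat.even_iff] at heven
  omega

theorem stmt8 (n k : ℕ) (hn : 2 ≤ n) (hkodd : Odd k) (hk0 : 0 < k) (hkn : k < n)
    (hgcd : Nat.gcd n k = 1) (w : ℕ) (hw0 : 0 < w) (hwn : w < n) (hwk : w * k ≡ 1 [MOD n])
    (j : ℤ) (hj : j ∈ S1 n k)
    (h0 : (dig n j 0 = 1 ∧ dig n j (n - k) = 2) ∨ (dig n j 0 = 2 ∧ dig n j (n - k) = 1))
    (h1 : (dig n j 1 = 0 ∧ dig n j (n - k + 1) = 1) ∨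
      (dig n j 1 = 1 ∧ dig n j (n - k + 1) = 0))
    (hj1 : dig n j 1 = 1) (hj0 : dig n j 0 = 2) :
    (∀ i, w ≤ i → i ≤ n - 1 → dig n j (i * k) = 1) ∧
    dig n j 0 = 2 ∧ dig n j k = 0 ∧ dig n j ((w - 1) * k) = 0 ∧
    (∀ i, 2 ≤ i → i ≤ w - 2 → dig n j (i * k) = 0 ∨ dig n j (i * k) = 2) ∧
    (∀ i, 2 ≤ i → i + 1 ≤ w - 2 →
      ¬(dig n j (i * k) = 2 ∧ dig n j ((i + 1) * k) = 2)) := by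
  have hsum0 : dig n j 0 + dig n j (n - k) = 3 := by omega
  have hinj {a b : ℕ} (ha : a < n) (hb : b < n) (h : a * k ≡ b * k [MOD n]) : a = b :=
    (Nat.ModEq.cancel_right_of_coprime hgcd h).eq_of_lt_of_lt ha hb
  have hw1 : dig n j (w * k) = 1 := (dig_congr j hwk).trans hj1
  have hstep : ∀ i, i + 1 < n → i + 1 ≠ w →
      dig n j ((i + 1) * k) + dig n j (i * k) = 0 ∨
        dig n j ((i + 1) * k) + dig n j (i * k) = 2 := by
    intro i hi hiw
    set m := (i + 1) * k % n with hm
    have hmk : m ≡ (i + 1) * k [MOD n] := Nat.mod_modEq _ _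
    have hmn : m < n := Nat.mod_lt _ (by omega)
    have hm0 : m ≠ 0 := by
      intro h
      rw [h] at hmk
      have := hinj (a := 0) (b := i + 1) (by omega) hi (by simpa using hmk)
      omega
    have hm1 : m ≠ 1 := by
      intro h
      rw [h] at hmk
      exact hiw (hinj hi hwn (hmk.symm.trans hwk.symm))
    have hprev : m + (n - k) ≡ i * k [MOD n] := by
      refine (hmk.add_right (n - k)).trans ?_
      rw [show (i + 1) * k + (n - k) = i * k + n by rw [add_mul]; omega]
      exact Nat.add_modEq_right
    have := even_dig_add_dig hn hkn hj hsum0 (i := m) (by omega) hmn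
    rwa [dig_congr j hmk, dig_congr j hprev] at this
  have hw_ne : w ≠ 1 := by
    rintro rfl
    have hk1 : k = 1 := by
      have : k ≡ 1 [MOD n] := by simpa using hwk
      exact this.eq_of_lt_of_lt hkn (by omega)
    subst hk1
    rw [Nat.sub_add_cancel (by omega), dig_congr j (show n ≡ 0 [MOD n] by simp [Nat.ModEq])] at h1
    omega
  have hwprev : dig n j ((w - 1) * k) = 0 := by
    have h : (w - 1) * k ≡ n - k + 1 [MOD n] := by
      refine Nat.ModEq.add_right_cancel' k ?_
      rw [← Nat.succ_mul, Nat.succ_eq_add_one, Nat.sub_add_cancel hw0,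
        show n - k + 1 + k = 1 + n by omega]
      exact hwk.trans Nat.add_modEq_right.symm
    rw [dig_congr j h]
    omega
  have hk_zero : dig n j k = 0 := by
    have := hstep 0 (by omega) (by omega)
    simp only [zero_add, one_mul, zero_mul] at this
    omega
  have hmid : ∀ i, 1 ≤ i → i < w → dig n j (i * k) = 0 ∨ dig n j (i * k) = 2 := by
    intro i hi
    induction i, hi using Nat.le_induction with
    | base => intro _; left; simpa using hk_zero
    | succ i _ ih =>
      intro hiw
      have := ih (by omega)
      have := hstep i (by omega) (by omega)
      omega
  refine ⟨fun i hwi => ?_, hj0, hk_zero, hwprev, fun i h2 hi => hmid i (by omega) (by omega),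
    fun i h2 hi => ?_⟩
  · induction i, hwi using Nat.le_induction with
    | base => exact fun _ => hw1
    | succ i _ ih =>
      intro hi
      have := ih (by omega)
      have := hstep i (by omega) (by omega)
      omega
  · have := hstep i (by omega) (by omega)
    omega
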